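/- The conditional transformation S^V is a locally-applicable transformation on any symmetric monoidal groupoid: let G be a symmetric monoidal category in which every morphism is an isomorphism, let A, A' be objects and V : A' ⟶ A' a morphism. Define the family S^V by S^V_{X,X'}(φ) := (V ⊗ 𝟙_{X'}) ∘ φ if φ : A ⊗ X ⟶ A' ⊗ X' is NoPath, and S^V_{X,X'}(φ) := φ otherwise. Then S^V is a locally-applicable transformation of type [A,A'] → [A,A']. -/

import Mathlib

open CategoryTheory MonoidalCategory

universe v u

variable {G : Type u} [Category.{v} G] [MonoidalCategory G] [SymmetricCategory G]

/-- A family of functions of type `[A,A'] → [B,B']`. -/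
def Fam (A A' B B' : G) : Type _ :=
  ∀ X X' : G, (A ⊗ X ⟶ A' ⊗ X') → (B ⊗ X ⟶ B' ⊗ X')

/-- A family is a locally-applicable transformation if it is natural in the extensions. -/
def IsLAT {A A' B B' : G} (S : Fam A A' B B') : Prop :=
  ∀ {X X' Y Y' : G} (a : Y ⟶ X) (b : X' ⟶ Y') (φ : A ⊗ X ⟶ A' ⊗ X'),
    S Y Y' ((A ◁ a) ≫ φ ≫ (A' ◁ b)) = (B ◁ a) ≫ S X X' φ ≫ (B' ◁ b)

/-- A morphism `φ : A ⊗ X ⟶ A' ⊗ X'` admits a one-way factorization (is `NoPath`)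
if there exist `M`, `g : X ⟶ M ⊗ X'` and `f : A ⊗ M ⟶ A'` such that
`φ = (f ⊗ 𝟙_{X'}) ∘ (𝟙_A ⊗ g)` (associators inserted). -/
def NoPath {A A' X X' : G} (φ : A ⊗ X ⟶ A' ⊗ X') : Prop :=
  ∃ (M : G) (g : X ⟶ M ⊗ X') (f : A ⊗ M ⟶ A'),
    φ = (A ◁ g) ≫ (α_ A M X').inv ≫ (f ▷ X')

open Classical in
/-- The conditional transformation `S^V`: apply `V ⊗ 𝟙` after `φ` if `φ` is `NoPath`,
and do nothing otherwise. -/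
noncomputable def SV {A A' : G} (V : A' ⟶ A') : Fam A A' A A' :=
  fun _X X' φ => if NoPath φ then φ ≫ (V ▷ X') else φ

theorem NoPath.comp_aux {A A' X X' Y Y' : G} (a : Y ⟶ X) (b : X' ⟶ Y')
    {φ : A ⊗ X ⟶ A' ⊗ X'} (h : NoPath φ) : NoPath ((A ◁ a) ≫ φ ≫ (A' ◁ b)) := by
  obtain ⟨M, g, f, rfl⟩ := h
  refine ⟨M, a ≫ g ≫ (M ◁ b), f, ?_⟩
  simp only [MonoidalCategory.whiskerLeft_comp, Category.assoc]
  rw [← whisker_exchange, associator_inv_naturality_right_assoc]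

/-- On a symmetric monoidal groupoid, `S^V` is a locally-applicable transformation of
type `[A,A'] → [A,A']`. -/
theorem SV_isLAT (hG : ∀ {X Y : G} (f : X ⟶ Y), IsIso f)
    {A A' : G} (V : A' ⟶ A') : IsLAT (SV (A := A) V) := by
  intro X X' Y Y' a b φ
  have key : NoPath ((A ◁ a) ≫ φ ≫ (A' ◁ b)) ↔ NoPath φ := by
    refine ⟨fun h => ?_, fun h => h.comp_aux a b⟩
    haveI := hG a
    haveI := hG b
    have h2 := h.comp_aux (inv a) (inv b)
    have e : (A ◁ inv a) ≫ ((A ◁ a) ≫ φ ≫ (A' ◁ b)) ≫ (A' ◁ inv b) = φ := by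
      simp
    rwa [e] at h2
  unfold SV
  by_cases h : NoPath φ
  · rw [if_pos (key.2 h), if_pos h]
    simp only [Category.assoc]
    rw [whisker_exchange]
  · rw [if_neg (fun h' => h (key.1 h')), if_neg h]
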